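/- Let G be a finite simple bipartite graph. Then Ψ(G) is a greedoid on the vertex set of G if and only if all maximum matchings of G are uniquely restricted. -/

import Mathlib

open Classical

variable {V : Type*} [Fintype V] [DecidableEq V]

/-- `S` is a stable (independent) set of vertices in `G`. -/
def IsStable (G : SimpleGraph V) (S : Finset V) : Prop :=
  ∀ ⦃x⦄, x ∈ S → ∀ ⦃y⦄, y ∈ S → ¬G.Adj x y

/-- The open neighborhood `N(S)`: vertices outside `S` having a neighbor in `S`. -/
noncomputable def nbhd (G : SimpleGraph V) (S : Finset V) : Finset V :=
  Finset.univ.filter fun v => v ∉ S ∧ ∃ u ∈ S, G.Adj u v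

/-- The closed neighborhood `N[S] = S ∪ N(S)`. -/
noncomputable def closedNbhd (G : SimpleGraph V) (S : Finset V) : Finset V :=
  S ∪ nbhd G S

/-- The stability (independence) number of the subgraph of `G` induced by `A`. -/
noncomputable def alphaOn (G : SimpleGraph V) (A : Finset V) : ℕ :=
  sSup {n | ∃ S ⊆ A, IsStable G S ∧ S.card = n}

/-- The stability (independence) number `α(G)`. -/
noncomputable def alpha (G : SimpleGraph V) : ℕ :=
  alphaOn G Finset.univ

/-- `S` is a maximum stable set of the subgraph of `G` induced by `N[S]`. -/
def IsLocalMaxStable (G : SimpleGraph V) (S : Finset V) : Prop :=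
  IsStable G S ∧ S.card = alphaOn G (closedNbhd G S)

/-- `Ψ(G)`: the family of all local maximum stable sets of `G`. -/
def Psi (G : SimpleGraph V) : Set (Finset V) :=
  {S | IsLocalMaxStable G S}

/-- A matching of `G`: a set of pairwise disjoint edges of `G`. -/
def IsGMatching (G : SimpleGraph V) (M : Finset (Sym2 V)) : Prop :=
  (∀ e ∈ M, e ∈ G.edgeSet) ∧
    ∀ e ∈ M, ∀ f ∈ M, e ≠ f → ∀ v : V, v ∈ e → v ∉ f

/-- A matching of `G` all of whose edges have both endpoints inside `A`,
i.e. a matching of the subgraph of `G` induced by `A`. -/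
def IsGMatchingOn (G : SimpleGraph V) (A : Finset V) (M : Finset (Sym2 V)) : Prop :=
  IsGMatching G M ∧ ∀ e ∈ M, ∀ v : V, v ∈ e → v ∈ A

/-- The matching number of the subgraph of `G` induced by `A`. -/
noncomputable def muOn (G : SimpleGraph V) (A : Finset V) : ℕ :=
  sSup {n | ∃ M, IsGMatchingOn G A M ∧ M.card = n}

/-- The matching number `μ(G)`. -/
noncomputable def mu (G : SimpleGraph V) : ℕ :=
  muOn G Finset.univ

/-- A maximum matching of `G`. -/
def IsMaximumGMatching (G : SimpleGraph V) (M : Finset (Sym2 V)) : Prop :=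
  IsGMatching G M ∧ M.card = mu G

/-- The matching `M` saturates the vertex `v`. -/
def MSaturates (M : Finset (Sym2 V)) (v : V) : Prop :=
  ∃ e ∈ M, v ∈ e

/-- A perfect matching of `G`: a matching saturating every vertex. -/
def IsPerfectGMatching (G : SimpleGraph V) (M : Finset (Sym2 V)) : Prop :=
  IsGMatching G M ∧ ∀ v : V, MSaturates M v

/-- The set of vertices saturated by `M`. -/
noncomputable def msupp (M : Finset (Sym2 V)) : Finset V :=
  Finset.univ.filter fun v => ∃ e ∈ M, v ∈ e

/-- `M` is a uniquely restricted matching: it is the unique perfect matching of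
the subgraph of `G` induced by the set of vertices saturated by `M`. -/
def UniquelyRestricted (G : SimpleGraph V) (M : Finset (Sym2 V)) : Prop :=
  IsGMatching G M ∧
    ∀ M' : Finset (Sym2 V), IsGMatchingOn G (msupp M) M' →
      (∀ v ∈ msupp M, MSaturates M' v) → M' = M

/-- Accessibility property of a set system. -/
def AccessibleFam (F : Set (Finset V)) : Prop :=
  ∀ X ∈ F, X ≠ ∅ → ∃ x ∈ X, X.erase x ∈ F

/-- Exchange property of a set system. -/
def ExchangeFam (F : Set (Finset V)) : Prop :=
  ∀ X ∈ F, ∀ Y ∈ F, X.card = Y.card + 1 → ∃ x ∈ X, x ∉ Y ∧ insert x Y ∈ F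

/-- A greedoid: a nonempty set system satisfying accessibility and exchange. -/
def IsGreedoidFam (F : Set (Finset V)) : Prop :=
  F.Nonempty ∧ AccessibleFam F ∧ ExchangeFam F

/-- A maximal stable set. -/
def IsMaximalStable (G : SimpleGraph V) (S : Finset V) : Prop :=
  IsStable G S ∧ ∀ T, IsStable G T → S ⊆ T → S = T

/-- `G` is well-covered: all maximal stable sets have the same cardinality. -/
def WellCovered (G : SimpleGraph V) : Prop :=
  ∀ S T, IsMaximalStable G S → IsMaximalStable G T → S.card = T.card

/-- `G` is very well-covered: well-covered, no isolated vertices, `|V| = 2α(G)`. -/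
def VeryWellCovered (G : SimpleGraph V) : Prop :=
  WellCovered G ∧ (∀ v : V, ∃ u, G.Adj v u) ∧ Fintype.card V = 2 * alpha G

/-- The subgraph of `G` induced by `A` is a König-Egerváry graph. -/
def KonigEgervaryOn (G : SimpleGraph V) (A : Finset V) : Prop :=
  alphaOn G A + muOn G A = A.card

/-- `G` is a König-Egerváry graph: `α(G) + μ(G) = |V(G)|`. -/
def KonigEgervary (G : SimpleGraph V) : Prop :=
  alpha G + mu G = Fintype.card V

/-- The cycle `c` is alternating with respect to `M`: of every two incident
edges of `c` exactly one belongs to `M`. -/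
def IsAlternatingCycle (G : SimpleGraph V) (M : Finset (Sym2 V)) {v : V}
    (c : G.Walk v v) : Prop :=
  c.IsCycle ∧ ∀ e ∈ c.edges, ∀ f ∈ c.edges, e ≠ f →
    (∃ u : V, u ∈ e ∧ u ∈ f) → (e ∈ M ↔ f ∉ M)

/-- `G` contains an `M`-alternating cycle. -/
def HasAlternatingCycle (G : SimpleGraph V) (M : Finset (Sym2 V)) : Prop :=
  ∃ (v : V) (c : G.Walk v v), IsAlternatingCycle G M c

/-- The cycle `c` is chordless: the subgraph induced by its vertices has no
edges other than the cycle edges. -/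
def ChordlessCycle (G : SimpleGraph V) {v : V} (c : G.Walk v v) : Prop :=
  ∀ x ∈ c.support, ∀ y ∈ c.support, G.Adj x y → s(x, y) ∈ c.edges

omit [Fintype V] [DecidableEq V] in
theorem card_le_alphaOn {G : SimpleGraph V} {A S : Finset V} (hSA : S ⊆ A) (hS : IsStable G S) :
    S.card ≤ alphaOn G A :=
  le_csSup ⟨A.card, by rintro n ⟨T, hT, -, rfl⟩; exact Finset.card_le_card hT⟩
    ⟨S, hSA, hS, rfl⟩

omit [Fintype V] [DecidableEq V] in
theorem exists_card_eq_alphaOn (G : SimpleGraph V) (A : Finset V) :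
    ∃ S ⊆ A, IsStable G S ∧ S.card = alphaOn G A :=
  Nat.sSup_mem (s := {n | ∃ S ⊆ A, IsStable G S ∧ S.card = n})
    ⟨0, ∅, by simp, by simp [IsStable], by simp⟩
    ⟨A.card, by rintro n ⟨T, hT, -, rfl⟩; exact Finset.card_le_card hT⟩

theorem mem_nbhd {G : SimpleGraph V} {S : Finset V} {v : V} :
    v ∈ nbhd G S ↔ v ∉ S ∧ ∃ u ∈ S, G.Adj u v := by
  simp [nbhd]

theorem mem_closedNbhd {G : SimpleGraph V} {S : Finset V} {v : V} :
    v ∈ closedNbhd G S ↔ v ∈ S ∨ ∃ u ∈ S, G.Adj u v := by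
  simp only [closedNbhd, Finset.mem_union, mem_nbhd]
  tauto

theorem isLocalMaxStable_iff_forall_card_le {G : SimpleGraph V} {S : Finset V} :
    IsLocalMaxStable G S ↔
      IsStable G S ∧ ∀ T ⊆ closedNbhd G S, IsStable G T → T.card ≤ S.card := by
  constructor
  · rintro ⟨hS, hc⟩
    exact ⟨hS, fun T hT hs => hc ▸ card_le_alphaOn hT hs⟩
  · rintro ⟨hS, hmax⟩
    obtain ⟨T, hT, hs, hc⟩ := exists_card_eq_alphaOn G (closedNbhd G S)
    exact ⟨hS, le_antisymm (card_le_alphaOn Finset.subset_union_left hS) (hc ▸ hmax T hT hs)⟩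

omit [DecidableEq V] in
theorem isMaximumGMatching_iff_forall_card_le {G : SimpleGraph V} {M : Finset (Sym2 V)} :
    IsMaximumGMatching G M ↔
      IsGMatching G M ∧ ∀ M', IsGMatching G M' → M'.card ≤ M.card := by
  have hbdd : BddAbove {n | ∃ M, IsGMatchingOn G Finset.univ M ∧ M.card = n} :=
    ⟨Fintype.card (Sym2 V), by rintro n ⟨T, -, rfl⟩; exact Finset.card_le_univ T⟩
  have hle : ∀ M', IsGMatching G M' → M'.card ≤ mu G := fun M' h =>
    le_csSup hbdd ⟨M', ⟨h, by simp⟩, rfl⟩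
  obtain ⟨N, hN, hNc⟩ := Nat.sSup_mem
    (s := {n | ∃ M, IsGMatchingOn G Finset.univ M ∧ M.card = n})
    ⟨0, ∅, by simp [IsGMatchingOn, IsGMatching], by simp⟩ hbdd
  constructor
  · rintro ⟨h, hc⟩
    exact ⟨h, fun M' h' => hc ▸ hle M' h'⟩
  · rintro ⟨h, hmax⟩
    exact ⟨h, le_antisymm (hle M h) ((show N.card = mu G from hNc) ▸ hmax N hN.1)⟩

/-- `m` matches the vertices of `T` injectively with neighbors in `S`. -/
def MatchesInto (G : SimpleGraph V) (m : V → V) (T S : Finset V) : Prop :=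
  Set.InjOn m T ∧ ∀ v ∈ T, m v ∈ S ∧ G.Adj v (m v)

omit [Fintype V] [DecidableEq V] in
theorem MatchesInto.card_le {G : SimpleGraph V} {m : V → V} {T S : Finset V}
    (h : MatchesInto G m T S) : T.card ≤ S.card :=
  Finset.card_le_card_of_injOn m (fun v hv => (h.2 v hv).1) h.1

theorem card_le_card_neighbors_of_isLocalMaxStable {G : SimpleGraph V} {S X : Finset V}
    (hS : IsLocalMaxStable G S) (hX : IsStable G X) (hXS : X ⊆ nbhd G S) :
    X.card ≤ (S.filter fun u => ∃ v ∈ X, G.Adj v u).card := by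
  rw [isLocalMaxStable_iff_forall_card_le] at hS
  obtain ⟨hs, hmax⟩ := hS
  have hdisj : Disjoint X (S.filter fun u => ¬∃ v ∈ X, G.Adj v u) := by
    rw [Finset.disjoint_left]
    intro v hv hv'
    exact (mem_nbhd.1 (hXS hv)).1 (Finset.mem_filter.1 hv').1
  have h := hmax (X ∪ S.filter fun u => ¬∃ v ∈ X, G.Adj v u) ?_ ?_
  · rw [Finset.card_union_of_disjoint hdisj] at h
    have := Finset.card_filter_add_card_filter_not (s := S) (fun u => ∃ v ∈ X, G.Adj v u)
    omega
  · intro v hv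
    rcases Finset.mem_union.1 hv with hv | hv
    · exact Finset.mem_union_right _ (hXS hv)
    · exact Finset.mem_union_left _ (Finset.mem_filter.1 hv).1
  · intro x hx y hy hxy
    simp only [Finset.mem_union, Finset.mem_filter] at hx hy
    rcases hx with hx | hx <;> rcases hy with hy | hy
    · exact hX hx hy hxy
    · exact hy.2 ⟨x, hx, hxy⟩
    · exact hx.2 ⟨y, hy, hxy.symm⟩
    · exact hs hx.1 hy.1 hxy

theorem isLocalMaxStable_of_matchesInto {G : SimpleGraph V} {S : Finset V} {m : V → V}
    (hS : IsStable G S) (hm : MatchesInto G m (nbhd G S) S) : IsLocalMaxStable G S := by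
  rw [isLocalMaxStable_iff_forall_card_le]
  refine ⟨hS, fun T hT hs => ?_⟩
  have h : (T \ S).card ≤ (S \ T).card := by
    have hTS : ∀ v ∈ T \ S, v ∈ nbhd G S := by
      intro v hv
      have := hT (Finset.mem_sdiff.1 hv).1
      simpa [closedNbhd, (Finset.mem_sdiff.1 hv).2] using this
    refine Finset.card_le_card_of_injOn m (fun v hv => ?_) (hm.1.mono fun v hv => hTS v hv)
    have hv' := hm.2 v (hTS v hv)
    exact Finset.mem_sdiff.2 ⟨hv'.1, fun h => hs (Finset.mem_sdiff.1 hv).1 h hv'.2⟩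
  have h1 := Finset.card_sdiff_add_card_inter T S
  have h2 := Finset.card_sdiff_add_card_inter S T
  rw [Finset.inter_comm] at h2
  omega

theorem exists_matchesInto_of_isLocalMaxStable {G : SimpleGraph V}
    (hb : ∃ A : Set V, ∀ x y : V, G.Adj x y → (x ∈ A ↔ y ∉ A)) {S : Finset V}
    (hS : IsLocalMaxStable G S) : ∃ m, MatchesInto G m (nbhd G S) S := by
  obtain ⟨A, hA⟩ := hb
  have hall : ∀ X ⊆ nbhd G S, X.card ≤ (S.filter fun u => ∃ v ∈ X, G.Adj v u).card := by
    intro X hX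
    have h1 := card_le_card_neighbors_of_isLocalMaxStable (X := X.filter (· ∈ A)) hS
      (fun x hx y hy hxy => by
        have := hA x y hxy
        simp only [Finset.mem_filter] at hx hy
        tauto) ((Finset.filter_subset _ _).trans hX)
    have h2 := card_le_card_neighbors_of_isLocalMaxStable (X := X.filter (· ∉ A)) hS
      (fun x hx y hy hxy => by
        have := hA x y hxy
        simp only [Finset.mem_filter] at hx hy
        tauto) ((Finset.filter_subset _ _).trans hX)
    have h3 := Finset.card_filter_add_card_filter_not (s := X) (· ∈ A)
    have hdisj : Disjoint (S.filter fun u => ∃ v ∈ X.filter (· ∈ A), G.Adj v u)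
        (S.filter fun u => ∃ v ∈ X.filter (· ∉ A), G.Adj v u) := by
      rw [Finset.disjoint_left]
      intro u hu hu'
      obtain ⟨-, v, hv, hvu⟩ := Finset.mem_filter.1 hu
      obtain ⟨-, w, hw, hwu⟩ := Finset.mem_filter.1 hu'
      have := hA v u hvu
      have := hA w u hwu
      simp only [Finset.mem_filter] at hv hw
      tauto
    have h4 := Finset.card_le_card (Finset.union_subset
      (Finset.monotone_filter_right S (q := fun u => ∃ v ∈ X, G.Adj v u)
        (fun u _ ⟨v, hv, h⟩ => ⟨v, (Finset.mem_filter.1 hv).1, h⟩))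
      (Finset.monotone_filter_right S (p := fun u => ∃ v ∈ X.filter (· ∉ A), G.Adj v u)
        (fun u _ ⟨v, hv, h⟩ => ⟨v, (Finset.mem_filter.1 hv).1, h⟩)) :
      (S.filter fun u => ∃ v ∈ X.filter (· ∈ A), G.Adj v u) ∪
        (S.filter fun u => ∃ v ∈ X.filter (· ∉ A), G.Adj v u) ⊆ _)
    rw [Finset.card_union_of_disjoint hdisj] at h4
    omega
  obtain ⟨f, hf, hfm⟩ := (Finset.all_card_le_biUnion_card_iff_exists_injective
    (fun v : {v // v ∈ nbhd G S} => S.filter fun u => G.Adj v u)).1 (by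
      intro s
      have h := hall (s.map ⟨Subtype.val, Subtype.val_injective⟩) (by
        intro v hv
        obtain ⟨w, -, rfl⟩ := Finset.mem_map.1 hv
        exact w.2)
      rw [Finset.card_map] at h
      refine h.trans (Finset.card_le_card ?_)
      intro u hu
      simp only [Finset.mem_filter, Finset.mem_map, Function.Embedding.coeFn_mk] at hu
      obtain ⟨huS, v, ⟨w, hw, rfl⟩, hwu⟩ := hu
      simp only [Finset.mem_biUnion, Finset.mem_filter]
      exact ⟨w, hw, huS, hwu⟩)
  refine ⟨fun v => if h : v ∈ nbhd G S then f ⟨v, h⟩ else v, ?_, ?_⟩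
  · intro v hv w hw hvw
    rw [Finset.mem_coe] at hv hw
    simp only [hv, hw, dif_pos] at hvw
    exact congrArg Subtype.val (hf hvw)
  · intro v hv
    simpa [hv] using hfm ⟨v, hv⟩

/-- Every local maximum stable set extends to a maximum stable set, all of whose complement is
its neighborhood. -/
theorem exists_max_superset {G : SimpleGraph V} {X : Finset V} (hX : IsLocalMaxStable G X) :
    ∃ S, X ⊆ S ∧ IsLocalMaxStable G S ∧ nbhd G S = Sᶜ := by
  obtain ⟨S, -, hS, hc⟩ := exists_card_eq_alphaOn G Finset.univ
  have hmax : ∀ T, IsStable G T → T.card ≤ S.card := fun T hT =>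
    hc ▸ card_le_alphaOn (Finset.subset_univ T) hT
  rw [isLocalMaxStable_iff_forall_card_le] at hX
  have hR : IsStable G (X ∪ S \ closedNbhd G X) := by
    intro x hx y hy hxy
    simp only [Finset.mem_union, Finset.mem_sdiff, mem_closedNbhd] at hx hy
    rcases hx with hx | hx <;> rcases hy with hy | hy
    · exact hX.1 hx hy hxy
    · exact hy.2 (.inr ⟨x, hx, hxy⟩)
    · exact hx.2 (.inr ⟨y, hy, hxy.symm⟩)
    · exact hS hx.1 hy.1 hxy
  have hRc : S.card ≤ (X ∪ S \ closedNbhd G X).card := by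
    rw [Finset.card_union_of_disjoint]
    · have h1 := hX.2 (S ∩ closedNbhd G X) Finset.inter_subset_right
        (fun x hx y hy => hS (Finset.mem_inter.1 hx).1 (Finset.mem_inter.1 hy).1)
      have h2 := Finset.card_sdiff_add_card_inter S (closedNbhd G X)
      omega
    · rw [Finset.disjoint_left]
      intro x hx hx'
      exact (Finset.mem_sdiff.1 hx').2 (mem_closedNbhd.2 (.inl hx))
  refine ⟨_, Finset.subset_union_left,
    isLocalMaxStable_iff_forall_card_le.2 ⟨hR, fun T _ hT => (hmax T hT).trans hRc⟩, ?_⟩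
  generalize X ∪ S \ closedNbhd G X = R at hR hRc
  ext v
  rw [mem_nbhd, Finset.mem_compl, and_iff_left_iff_imp]
  intro hv
  by_contra! hno
  have h := hmax (insert v R) (by
    intro x hx y hy hxy
    rcases Finset.mem_insert.1 hx with hx | hx <;> rcases Finset.mem_insert.1 hy with hy | hy
    · exact hxy.ne (hx.trans hy.symm)
    · exact hno y hy (hx ▸ hxy.symm)
    · exact hno x hx (hy ▸ hxy)
    · exact hR hx hy hxy)
  rw [Finset.card_insert_of_notMem hv] at h
  omega

theorem empty_mem_Psi (G : SimpleGraph V) : ∅ ∈ Psi G :=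
  isLocalMaxStable_of_matchesInto (m := id) (by simp [IsStable])
    ⟨Function.injective_id.injOn, fun v hv => by simp [mem_nbhd] at hv⟩

/-- The edges joining the vertices of `T` to their images under `m`. -/
noncomputable def matchingOf (m : V → V) (T : Finset V) : Finset (Sym2 V) :=
  T.image fun v => s(v, m v)

section matchingOf

variable {G : SimpleGraph V} {m : V → V} {S : Finset V}

theorem matchesInto_edge_inj (hm : MatchesInto G m Sᶜ S) {v w x : V} (hv : v ∉ S) (hw : w ∉ S)
    (hxv : x ∈ s(v, m v)) (hxw : x ∈ s(w, m w)) : v = w := by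
  have h1 := (hm.2 v (Finset.mem_compl.2 hv)).1
  have h2 := (hm.2 w (Finset.mem_compl.2 hw)).1
  have h3 := @hm.1 v (by simpa using hv) w (by simpa using hw)
  rw [Sym2.mem_iff] at hxv hxw
  rcases hxv with rfl | rfl <;> rcases hxw with h | h
  · exact h
  · exact absurd (h ▸ h2) hv
  · exact absurd (h ▸ h1) hw
  · exact h3 h

theorem isGMatching_matchingOf (hm : MatchesInto G m Sᶜ S) :
    IsGMatching G (matchingOf m Sᶜ) := by
  simp only [IsGMatching, matchingOf, Finset.mem_image, Finset.mem_compl]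
  constructor
  · rintro _ ⟨v, hv, rfl⟩
    exact (hm.2 v (Finset.mem_compl.2 hv)).2
  · rintro _ ⟨v, hv, rfl⟩ _ ⟨w, hw, rfl⟩ hne x hx hx'
    exact hne (matchesInto_edge_inj hm hv hw hx hx' ▸ rfl)

theorem card_matchingOf (hm : MatchesInto G m Sᶜ S) : (matchingOf m Sᶜ).card = Sᶜ.card := by
  refine Finset.card_image_of_injOn fun v hv w hw h => ?_
  rw [Finset.mem_coe, Finset.mem_compl] at hv hw
  have h' : s(v, m v) = s(w, m w) := h
  exact matchesInto_edge_inj hm hv hw (Sym2.mem_mk_left _ _) (h' ▸ Sym2.mem_mk_left _ _)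

end matchingOf

theorem exists_notMem_of_edge {G : SimpleGraph V} {S : Finset V} (hS : IsStable G S)
    {e : Sym2 V} (he : e ∈ G.edgeSet) : ∃ v ∈ e, v ∉ S := by
  induction e with
  | _ x y =>
    by_contra! h
    exact hS (h x (Sym2.mem_mk_left x y)) (h y (Sym2.mem_mk_right x y)) he

theorem exists_endpoint_notMem {G : SimpleGraph V} {M : Finset (Sym2 V)} {S : Finset V}
    (hM : IsGMatching G M) (hS : IsStable G S) :
    ∃ g : Sym2 V → V, ∀ e ∈ M, g e ∈ e ∧ g e ∉ S := by
  refine ⟨fun e => if h : ∃ v ∈ e, v ∉ S then h.choose else e.out.1, fun e he => ?_⟩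
  have h := exists_notMem_of_edge hS (hM.1 e he)
  simp only [dif_pos h]
  exact h.choose_spec

omit [Fintype V] in
theorem IsGMatching.eq_of_mem {G : SimpleGraph V} {M : Finset (Sym2 V)} (hM : IsGMatching G M)
    {e f : Sym2 V} (he : e ∈ M) (hf : f ∈ M) {v : V} (hve : v ∈ e) (hvf : v ∈ f) : e = f := by
  by_contra h
  exact hM.2 e he f hf h v hve hvf

theorem IsGMatching.card_le_card_compl {G : SimpleGraph V} {M : Finset (Sym2 V)} {S : Finset V}
    (hM : IsGMatching G M) (hS : IsStable G S) : M.card ≤ Sᶜ.card := by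
  obtain ⟨g, hg⟩ := exists_endpoint_notMem hM hS
  exact Finset.card_le_card_of_injOn g (fun e he => Finset.mem_compl.2 ((hg e he).2))
    fun e he f hf h => hM.eq_of_mem he hf (hg e he).1 (h ▸ (hg f hf).1)

theorem IsGMatching.exists_partner {G : SimpleGraph V} {M : Finset (Sym2 V)} {S : Finset V}
    (hM : IsGMatching G M) (hS : IsStable G S) (hc : M.card = Sᶜ.card) {v : V} (hv : v ∉ S) :
    ∃ u ∈ S, s(v, u) ∈ M := by
  obtain ⟨g, hg⟩ := exists_endpoint_notMem hM hS
  have hinj : Set.InjOn g M := fun e he f hf h => hM.eq_of_mem he hf (hg e he).1 (h ▸ (hg f hf).1)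
  have hsurj := Finset.surjOn_of_injOn_of_card_le g
    (fun e he => Finset.mem_coe.2 (Finset.mem_compl.2 ((hg e he).2))) hinj hc.ge
  obtain ⟨e, he, rfl⟩ := hsurj (show v ∈ (↑(Sᶜ) : Set V) by simpa using hv)
  obtain ⟨u, hu⟩ := Sym2.mem_iff_exists.1 (hg e he).1
  refine ⟨u, ?_, hu ▸ he⟩
  by_contra huS
  obtain ⟨f, hf, rfl⟩ := hsurj (show u ∈ (↑(Sᶜ) : Set V) by simpa using huS)
  have hfe : f = e := hM.eq_of_mem hf he (hg f hf).1 (hu ▸ Sym2.mem_mk_right _ _)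
  subst hfe
  have hadj := hM.1 f hf
  rw [hu] at hadj
  exact G.loopless.irrefl _ hadj

theorem IsGMatching.card_msupp {G : SimpleGraph V} {M : Finset (Sym2 V)}
    (hM : IsGMatching G M) : (msupp M).card = 2 * M.card := by
  have h : msupp M = M.biUnion Sym2.toFinset := by
    ext v
    simp [msupp]
  rw [h, Finset.card_biUnion, Finset.sum_const_nat (m := 2), mul_comm]
  · exact fun e he => Sym2.card_toFinset_of_not_isDiag e (G.not_isDiag_of_mem_edgeSet (hM.1 e he))
  · intro e he f hf hne
    rw [Function.onFun, Finset.disjoint_left]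
    intro v hv hv'
    exact hM.2 e he f hf hne v (by simpa using hv) (by simpa using hv')

/-- Two injective choices of neighbors agree on a local maximum stable set when `Psi G` is
accessible. -/
theorem eqOn_of_accessible {G : SimpleGraph V}
    (hb : ∃ A : Set V, ∀ x y : V, G.Adj x y → (x ∈ A ↔ y ∉ A)) (hacc : AccessibleFam (Psi G))
    {f g : V → V} (W : Finset V) (hW : W ∈ Psi G) (hf : Set.InjOn f W) (hg : Set.InjOn g W)
    (hfa : ∀ x ∈ W, G.Adj x (f x)) (hga : ∀ x ∈ W, G.Adj x (g x)) : ∀ x ∈ W, f x = g x := by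
  have himage : ∀ W ∈ Psi G, ∀ f : V → V, Set.InjOn f W → (∀ x ∈ W, G.Adj x (f x)) →
      W.image f = nbhd G W := by
    intro W hW f hf hfa
    obtain ⟨m, hm⟩ := exists_matchesInto_of_isLocalMaxStable hb hW
    refine Finset.eq_of_subset_of_card_le (fun v hv => ?_) ?_
    · obtain ⟨x, hx, rfl⟩ := Finset.mem_image.1 hv
      exact mem_nbhd.2 ⟨fun h => hW.1 hx h (hfa x hx), x, hx, hfa x hx⟩
    · rw [Finset.card_image_of_injOn hf]
      exact hm.card_le
  induction hn : W.card generalizing W with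
  | zero =>
    intro x hx
    simp [Finset.card_eq_zero.1 hn] at hx
  | succ n ih =>
    obtain ⟨x, hx, hxW⟩ := hacc W hW (by rintro rfl; simp at hn)
    have hsub : W.erase x ⊆ W := Finset.erase_subset x W
    have hsub' : ((W.erase x : Finset V) : Set V) ⊆ W := Finset.coe_subset.2 hsub
    have hfa' : ∀ y ∈ W.erase x, G.Adj y (f y) := fun y hy => hfa y (hsub hy)
    have hga' : ∀ y ∈ W.erase x, G.Adj y (g y) := fun y hy => hga y (hsub hy)
    have ih' := ih _ hxW (hf.mono hsub') (hg.mono hsub') hfa' hga'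
      (by rw [Finset.card_erase_of_mem hx, hn]; rfl)
    intro y hy
    by_cases hyx : y = x
    · subst hyx
      have h : f y ∈ W.image g := by
        rw [himage W hW g hg hga, ← himage W hW f hf hfa]
        exact Finset.mem_image_of_mem f hy
      obtain ⟨z, hz, hzy⟩ := Finset.mem_image.1 h
      by_cases hzy' : z = y
      · rw [← hzy, hzy']
      · have := ih' z (Finset.mem_erase.2 ⟨hzy', hz⟩)
        exact absurd (hf hz hy (this.trans hzy)) hzy'
    · exact ih' y (Finset.mem_erase.2 ⟨hyx, hy⟩)

theorem uniquelyRestricted_of_accessible {G : SimpleGraph V}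
    (hb : ∃ A : Set V, ∀ x y : V, G.Adj x y → (x ∈ A ↔ y ∉ A)) (hacc : AccessibleFam (Psi G))
    {M : Finset (Sym2 V)} (hM : IsMaximumGMatching G M) : UniquelyRestricted G M := by
  rw [isMaximumGMatching_iff_forall_card_le] at hM
  obtain ⟨hM, hmax⟩ := hM
  refine ⟨hM, fun M' hM' hsat => ?_⟩
  obtain ⟨S, -, hS, hSc⟩ := exists_max_superset (empty_mem_Psi G)
  obtain ⟨m₀, hm₀⟩ := exists_matchesInto_of_isLocalMaxStable hb hS
  rw [hSc] at hm₀
  have hc : M.card = Sᶜ.card := le_antisymm (hM.card_le_card_compl hS.1)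
    (card_matchingOf hm₀ ▸ hmax _ (isGMatching_matchingOf hm₀))
  have hsupp : msupp M' = msupp M := by
    ext v
    constructor
    · intro hv
      obtain ⟨e, he, hve⟩ : ∃ e ∈ M', v ∈ e := by simpa [msupp] using hv
      exact hM'.2 e he v hve
    · intro hv
      simpa [msupp, MSaturates] using hsat v hv
  have hcc : M.card = M'.card := by
    have h1 := hM.card_msupp
    have h2 := hM'.1.card_msupp
    rw [hsupp] at h2
    omega
  choose! m hmS hmM using fun v (hv : v ∉ S) => hM.exists_partner hS.1 hc hv
  have hX : ∀ x, x ∈ msupp M ∩ S ↔ (∃ e ∈ M, x ∈ e) ∧ x ∈ S := by simp [msupp]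
  have hXPsi : msupp M ∩ S ∈ Psi G := by
    refine isLocalMaxStable_of_matchesInto (m := m)
      (fun x hx y hy => hS.1 ((hX x).1 hx).2 ((hX y).1 hy).2) ⟨?_, fun v hv => ?_⟩
    · have hnS : ∀ v ∈ nbhd G (msupp M ∩ S), v ∉ S := by
        intro v hv hvS
        obtain ⟨-, u, hu, huv⟩ := mem_nbhd.1 hv
        exact hS.1 ((hX u).1 hu).2 hvS huv
      intro v hv w hw hvw
      have hv' := hnS v hv
      have hw' := hnS w hw
      have h := hM.eq_of_mem (hmM v hv') (hmM w hw') (Sym2.mem_mk_right _ _)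
        (hvw ▸ Sym2.mem_mk_right _ _)
      rw [← hvw] at h
      exact Sym2.congr_left.1 h
    · obtain ⟨-, u, hu, huv⟩ := mem_nbhd.1 hv
      have hvS : v ∉ S := fun hvS => hS.1 ((hX u).1 hu).2 hvS huv
      exact ⟨(hX _).2 ⟨⟨_, hmM v hvS, Sym2.mem_mk_right _ _⟩, hmS v hvS⟩, hM.1 _ (hmM v hvS)⟩
  have hpartner : ∀ N : Finset (Sym2 V), msupp N = msupp M → ∀ x ∈ msupp M ∩ S,
      ∃ u, s(x, u) ∈ N := by
    intro N hN x hx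
    rw [← hN] at hx
    obtain ⟨e, he, hxe⟩ : ∃ e ∈ N, x ∈ e := by
      simpa [msupp] using (Finset.mem_inter.1 hx).1
    obtain ⟨u, rfl⟩ := Sym2.mem_iff_exists.1 hxe
    exact ⟨u, he⟩
  choose! f hf using hpartner M rfl
  choose! g hg using hpartner M' hsupp
  have hinj : ∀ N : Finset (Sym2 V), IsGMatching G N → ∀ h : V → V,
      (∀ x ∈ msupp M ∩ S, s(x, h x) ∈ N) →
      Set.InjOn h ((msupp M ∩ S : Finset V) : Set V) := by
    intro N hN h hh x hx y hy hxy
    have := hN.eq_of_mem (hh x hx) (hh y hy) (Sym2.mem_mk_right _ _)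
      (hxy ▸ Sym2.mem_mk_right _ _)
    rw [← hxy] at this
    exact Sym2.congr_left.1 this
  have hfg := eqOn_of_accessible hb hacc _ hXPsi (hinj M hM f hf) (hinj M' hM'.1 g hg)
    (fun x hx => hM.1 _ (hf x hx)) (fun x hx => hM'.1.1 _ (hg x hx))
  refine (Finset.eq_of_subset_of_card_le (fun e he => ?_) hcc.ge).symm
  obtain ⟨v, hve, hvS⟩ := exists_notMem_of_edge hS.1 (hM.1 e he)
  have hev : e = s(v, m v) := hM.eq_of_mem he (hmM v hvS) hve (Sym2.mem_mk_left _ _)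
  have hmX : m v ∈ msupp M ∩ S := (hX _).2 ⟨⟨_, hmM v hvS, Sym2.mem_mk_right _ _⟩, hmS v hvS⟩
  have hef : e = s(m v, f (m v)) :=
    hM.eq_of_mem he (hf _ hmX) (hev ▸ Sym2.mem_mk_right _ _) (Sym2.mem_mk_left _ _)
  rw [hef, hfg _ hmX]
  exact hg _ hmX

/-- A self-map of a finite set without fixed points yields a permutation that is not the identity
and moves points only as the map does. -/
theorem exists_injective_of_no_fixedPoint {X : Finset V} (hX : X.Nonempty) {g : V → V}
    (hgX : ∀ x ∈ X, g x ∈ X) (hgne : ∀ x ∈ X, g x ≠ x) :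
    ∃ σ : V → V, Function.Injective σ ∧ (∀ x ∉ X, σ x = x) ∧
      (∀ x ∈ X, σ x = g x ∨ σ x = x) ∧ ∃ x ∈ X, σ x ≠ x := by
  let h : V → V := fun x => if x ∈ X then g x else x
  have hh : ∀ x ∈ X, h x = g x := fun x hx => if_pos hx
  have hbij := Function.bijOn_periodicPts h
  refine ⟨fun x => if x ∈ Function.periodicPts h then h x else x, ?_, ?_, ?_, ?_⟩
  · intro x y hxy
    by_cases hx : x ∈ Function.periodicPts h <;> by_cases hy : y ∈ Function.periodicPts h <;>
      simp only [hx, hy, if_true, if_false] at hxy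
    · exact hbij.injOn hx hy hxy
    · exact absurd (hxy ▸ hbij.mapsTo hx) hy
    · exact absurd (hxy ▸ hbij.mapsTo hy) hx
    · exact hxy
  · intro x hx
    simp [h, hx]
  · intro x hx
    by_cases hp : x ∈ Function.periodicPts h
    · simp [hp, hh x hx]
    · simp [hp]
  · obtain ⟨x, hx⟩ := hX
    have hiter : ∀ n, h^[n] x ∈ X := by
      intro n
      induction n with
      | zero => exact hx
      | succ n ih =>
        rw [Function.iterate_succ_apply', hh _ ih]
        exact hgX _ ih
    obtain ⟨i, j, hij, heq⟩ := Finite.exists_ne_map_eq_of_infinite fun n => h^[n] x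
    wlog hlt : i < j generalizing i j
    · exact this j i hij.symm heq.symm (by omega)
    have hp : h^[i] x ∈ Function.periodicPts h := by
      refine ⟨j - i, by omega, ?_⟩
      change h^[j - i] (h^[i] x) = h^[i] x
      rw [← Function.iterate_add_apply, Nat.sub_add_cancel hlt.le]
      exact heq.symm
    refine ⟨h^[i] x, hiter i, ?_⟩
    simp only [if_pos hp, hh _ (hiter i)]
    exact hgne _ (hiter i)

theorem erase_mem_Psi {G : SimpleGraph V} {X : Finset V} {m : V → V} (hX : IsStable G X)
    (hm : MatchesInto G m (nbhd G X) X) {x : V}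
    (h : ∀ v ∈ nbhd G (X.erase x), m v ≠ x) : X.erase x ∈ Psi G := by
  have hsub : nbhd G (X.erase x) ⊆ nbhd G X := by
    intro v hv
    obtain ⟨-, u, hu, huv⟩ := mem_nbhd.1 hv
    have huX := (Finset.mem_erase.1 hu).2
    exact mem_nbhd.2 ⟨fun hvX => hX huX hvX huv, u, huX, huv⟩
  refine isLocalMaxStable_of_matchesInto (m := m)
    (fun y hy z hz => hX (Finset.mem_erase.1 hy).2 (Finset.mem_erase.1 hz).2)
    ⟨hm.1.mono (Finset.coe_subset.2 hsub), fun v hv => ?_⟩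
  exact ⟨Finset.mem_erase.2 ⟨h v hv, (hm.2 v (hsub hv)).1⟩, (hm.2 v (hsub hv)).2⟩

/-- A matching of the neighborhood of a local maximum stable set `X` into `X` extends to
a matching of the complement of a maximum stable set containing `X`. -/
theorem exists_matchesInto_extension {G : SimpleGraph V}
    (hb : ∃ A : Set V, ∀ x y : V, G.Adj x y → (x ∈ A ↔ y ∉ A)) {X : Finset V}
    (hX : IsLocalMaxStable G X) :
    ∃ (S : Finset V) (m : V → V), X ⊆ S ∧ IsStable G S ∧ MatchesInto G m Sᶜ S ∧
      MatchesInto G m (nbhd G X) X := by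
  obtain ⟨S, hXS, hS, hSc⟩ := exists_max_superset hX
  obtain ⟨m₀, hm₀⟩ := exists_matchesInto_of_isLocalMaxStable hb hS
  obtain ⟨m₁, hm₁⟩ := exists_matchesInto_of_isLocalMaxStable hb hX
  rw [hSc] at hm₀
  let m : V → V := fun v => if v ∈ nbhd G X then m₁ v else m₀ v
  have hpos : ∀ v ∈ nbhd G X, m v = m₁ v := fun v hv => if_pos hv
  have hneg : ∀ v ∉ nbhd G X, m v = m₀ v := fun v hv => if_neg hv
  have hnX : ∀ v ∈ Sᶜ, v ∉ nbhd G X → m₀ v ∉ X := fun v hv hvX h => hvX (mem_nbhd.2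
    ⟨fun hvX' => Finset.mem_compl.1 hv (hXS hvX'), _, h, (hm₀.2 v hv).2.symm⟩)
  refine ⟨S, m, hXS, hS.1, ⟨?_, ?_⟩, ?_, ?_⟩
  · intro v hv w hw hvw
    by_cases h1 : v ∈ nbhd G X <;> by_cases h2 : w ∈ nbhd G X
    · rw [hpos v h1, hpos w h2] at hvw
      exact hm₁.1 h1 h2 hvw
    · rw [hpos v h1, hneg w h2] at hvw
      exact absurd (hvw ▸ (hm₁.2 v h1).1) (hnX w hw h2)
    · rw [hneg v h1, hpos w h2] at hvw
      exact absurd (hvw ▸ (hm₁.2 w h2).1) (hnX v hv h1)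
    · rw [hneg v h1, hneg w h2] at hvw
      exact hm₀.1 hv hw hvw
  · intro v hv
    by_cases h1 : v ∈ nbhd G X
    · rw [hpos v h1]
      exact ⟨hXS (hm₁.2 v h1).1, (hm₁.2 v h1).2⟩
    · rw [hneg v h1]
      exact hm₀.2 v hv
  · intro v hv w hw hvw
    rw [hpos v hv, hpos w hw] at hvw
    exact hm₁.1 hv hw hvw
  · intro v hv
    rw [hpos v hv]
    exact hm₁.2 v hv

theorem accessible_of_uniquelyRestricted {G : SimpleGraph V}
    (hb : ∃ A : Set V, ∀ x y : V, G.Adj x y → (x ∈ A ↔ y ∉ A))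
    (hur : ∀ M : Finset (Sym2 V), IsMaximumGMatching G M → UniquelyRestricted G M) :
    AccessibleFam (Psi G) := by
  intro X hX hne
  obtain ⟨S, m, hXS, hS, hm, hmX⟩ := exists_matchesInto_extension hb hX
  by_contra! hno
  have hkey : ∀ x ∈ X, ∃ v ∈ nbhd G X, m v = x ∧ ∃ u ∈ X, u ≠ x ∧ G.Adj v u := by
    intro x hx
    by_contra! hcon
    refine hno x hx (erase_mem_Psi hX.1 hmX fun v hv hvx => ?_)
    obtain ⟨-, u, hu, huv⟩ := mem_nbhd.1 hv
    obtain ⟨hux, huX⟩ := Finset.mem_erase.1 hu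
    exact hcon v (mem_nbhd.2 ⟨fun hvX => hX.1 huX hvX huv, u, huX, huv⟩) hvx u huX hux huv.symm
  choose! k hkX hmk g hgX hgne hgadj using hkey
  obtain ⟨σ, hσ, hσ_off, hσ_on, x, hx, hσx⟩ :=
    exists_injective_of_no_fixedPoint (Finset.nonempty_iff_ne_empty.2 hne) hgX hgne
  have hkS : ∀ x ∈ X, k x ∈ Sᶜ := by
    intro x hx
    obtain ⟨-, u, hu, huv⟩ := mem_nbhd.1 (hkX x hx)
    exact Finset.mem_compl.2 fun h => hS (hXS hu) h huv
  have hkm : ∀ v ∈ Sᶜ, m v ∈ X → k (m v) = v := fun v hv hvX =>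
    hm.1 (hkS _ hvX) hv (hmk _ hvX)
  have hm' : MatchesInto G (σ ∘ m) Sᶜ S := by
    refine ⟨fun v hv w hw hvw => hm.1 hv hw (hσ hvw), fun v hv => ?_⟩
    by_cases hvX : m v ∈ X
    · rcases hσ_on _ hvX with h | h
      · rw [Function.comp_apply, h]
        exact ⟨hXS (hgX _ hvX), by simpa [hkm v hv hvX] using hgadj _ hvX⟩
      · rw [Function.comp_apply, h]
        exact hm.2 v hv
    · rw [Function.comp_apply, hσ_off _ hvX]
      exact hm.2 v hv
  have hmsupp : ∀ v, v ∈ msupp (matchingOf m Sᶜ) ↔ v ∈ Sᶜ ∨ v ∈ Sᶜ.image m := by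
    intro v
    simp only [msupp, matchingOf, Finset.mem_filter, Finset.mem_univ, true_and, Finset.mem_image,
      exists_exists_and_eq_and, Sym2.mem_iff]
    constructor
    · rintro ⟨w, hw, rfl | rfl⟩
      · exact .inl hw
      · exact .inr ⟨w, hw, rfl⟩
    · rintro (hv | ⟨w, hw, rfl⟩)
      · exact ⟨v, hv, .inl rfl⟩
      · exact ⟨w, hw, .inr rfl⟩
  have himage : Sᶜ.image (σ ∘ m) = Sᶜ.image m := by
    refine Finset.eq_of_subset_of_card_le (fun u hu => ?_) ?_
    · obtain ⟨v, hv, rfl⟩ := Finset.mem_image.1 hu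
      by_cases hvX : m v ∈ X
      · have : σ (m v) ∈ X := by
          rcases hσ_on _ hvX with h | h <;> rw [h]
          exacts [hgX _ hvX, hvX]
        exact Finset.mem_image.2 ⟨k (σ (m v)), hkS _ this, hmk _ this⟩
      · rw [Function.comp_apply, hσ_off _ hvX]
        exact Finset.mem_image_of_mem m hv
    · rw [Finset.card_image_of_injOn hm'.1, Finset.card_image_of_injOn hm.1]
  have hM : IsMaximumGMatching G (matchingOf m Sᶜ) :=
    isMaximumGMatching_iff_forall_card_le.2 ⟨isGMatching_matchingOf hm, fun M' hM' =>
      card_matchingOf hm ▸ hM'.card_le_card_compl hS⟩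
  have heq := (hur _ hM).2 (matchingOf (σ ∘ m) Sᶜ)
    ⟨isGMatching_matchingOf hm', by
      intro e he v hve
      obtain ⟨w, hw, rfl⟩ := Finset.mem_image.1 he
      rw [hmsupp, ← himage]
      rcases Sym2.mem_iff.1 hve with rfl | rfl
      · exact .inl hw
      · exact .inr (Finset.mem_image_of_mem _ hw)⟩
    (by
      intro v hv
      rw [hmsupp, ← himage] at hv
      rcases hv with hv | hv
      · exact ⟨_, Finset.mem_image_of_mem _ hv, Sym2.mem_mk_left _ _⟩
      · obtain ⟨w, hw, rfl⟩ := Finset.mem_image.1 hv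
        exact ⟨_, Finset.mem_image_of_mem _ hw, Sym2.mem_mk_right _ _⟩)
  have hmem : s(k x, (σ ∘ m) (k x)) ∈ matchingOf m Sᶜ :=
    heq ▸ Finset.mem_image_of_mem (fun v => s(v, (σ ∘ m) v)) (hkS x hx)
  obtain ⟨w, hw, hweq⟩ := Finset.mem_image.1 hmem
  have hwk : w = k x := matchesInto_edge_inj hm (Finset.mem_compl.1 hw)
    (Finset.mem_compl.1 (hkS x hx)) (x := k x)
    (show k x ∈ s(w, m w) from hweq ▸ Sym2.mem_mk_left _ _) (Sym2.mem_mk_left _ _)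
  subst hwk
  have := Sym2.congr_right.1 hweq
  rw [Function.comp_apply, hmk x hx] at this
  exact hσx this.symm

omit [Fintype V] in
/-- In an accessible family, a member meeting `Q` contains a member meeting `Q` in one element. -/
theorem AccessibleFam.exists_single {F : Set (Finset V)} (hF : AccessibleFam F) (Q : V → Prop)
    (X : Finset V) (hX : X ∈ F) (hQ : ∃ x ∈ X, Q x) :
    ∃ W ∈ F, W ⊆ X ∧ ∃ x ∈ W, Q x ∧ ∀ y ∈ W, Q y → y = x := by
  induction hn : X.card generalizing X with
  | zero =>
    obtain ⟨x, hx, -⟩ := hQ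
    simp [Finset.card_eq_zero.1 hn] at hx
  | succ n ih =>
    obtain ⟨x, hx, hxF⟩ := hF X hX (by rintro rfl; simp at hn)
    by_cases h : ∃ y ∈ X.erase x, Q y
    · obtain ⟨W, hW, hWX, hW'⟩ :=
        ih _ hxF h (by rw [Finset.card_erase_of_mem hx, hn]; rfl)
      exact ⟨W, hW, hWX.trans (Finset.erase_subset x X), hW'⟩
    · push Not at h
      have huniq : ∀ y ∈ X, Q y → y = x := fun y hy hQy => by
        by_contra hyx
        exact h y (Finset.mem_erase.2 ⟨hyx, hy⟩) hQy
      obtain ⟨y, hy, hQy⟩ := hQ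
      exact ⟨X, hX, subset_rfl, x, hx, huniq y hy hQy ▸ hQy, huniq⟩

theorem exchange_of_accessible {G : SimpleGraph V}
    (hb : ∃ A : Set V, ∀ x y : V, G.Adj x y → (x ∈ A ↔ y ∉ A)) (hacc : AccessibleFam (Psi G)) :
    ExchangeFam (Psi G) := by
  intro X hX Y hY hcard
  obtain ⟨m, hm⟩ := exists_matchesInto_of_isLocalMaxStable hb hY
  have hex : ∃ x ∈ X, x ∉ closedNbhd G Y := by
    by_contra! h
    have h1 := (isLocalMaxStable_iff_forall_card_le.1 hY).2 X h hX.1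
    omega
  obtain ⟨W, hW, hWX, x, hxW, hxQ, huniq⟩ :=
    hacc.exists_single (fun x => x ∉ closedNbhd G Y) X hX hex
  have hxY : x ∉ Y := fun h => hxQ (mem_closedNbhd.2 (.inl h))
  have hxN : ∀ u ∈ Y, ¬G.Adj u x := fun u hu h => hxQ (mem_closedNbhd.2 (.inr ⟨u, hu, h⟩))
  refine ⟨x, hWX hxW, hxY, ?_⟩
  obtain ⟨k, hk⟩ := exists_matchesInto_of_isLocalMaxStable hb hW
  have hstable : IsStable G (insert x Y) := by
    intro a ha b hb' hab
    rcases Finset.mem_insert.1 ha with ha | ha <;> rcases Finset.mem_insert.1 hb' with hb' | hb'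
    · exact hab.ne (ha.trans hb'.symm)
    · exact hxN b hb' (ha ▸ hab.symm)
    · exact hxN a ha (hb' ▸ hab)
    · exact hY.1 ha hb' hab
  let D := nbhd G (insert x Y) \ nbhd G Y
  have hD : ∀ v ∈ D, v ∉ Y ∧ G.Adj x v ∧ ∀ u ∈ Y, ¬G.Adj u v := by
    intro v hv
    obtain ⟨hv1, hv2⟩ := Finset.mem_sdiff.1 hv
    obtain ⟨hv3, u, hu, huv⟩ := mem_nbhd.1 hv1
    have hvY : v ∉ Y := fun h => hv3 (Finset.mem_insert_of_mem h)
    have hno : ∀ u ∈ Y, ¬G.Adj u v := fun u hu h => hv2 (mem_nbhd.2 ⟨hvY, u, hu, h⟩)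
    rcases Finset.mem_insert.1 hu with rfl | hu
    · exact ⟨hvY, huv, hno⟩
    · exact absurd huv (hno u hu)
  let E := (W \ Y).erase x
  have hE : ∀ v ∈ E, v ∈ W ∧ v ∈ nbhd G Y := by
    intro v hv
    obtain ⟨hvx, hv⟩ := Finset.mem_erase.1 hv
    obtain ⟨hvW, hvY⟩ := Finset.mem_sdiff.1 hv
    refine ⟨hvW, ?_⟩
    by_contra h
    exact hvx (huniq v hvW (by simp [closedNbhd, hvY, h]))
  have hEimg : ∀ v ∈ E.image m, v ∈ nbhd G W ∧ v ∈ Y := by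
    intro v hv
    obtain ⟨w, hw, rfl⟩ := Finset.mem_image.1 hv
    obtain ⟨hwW, hwN⟩ := hE w hw
    obtain ⟨h1, h2⟩ := hm.2 w hwN
    exact ⟨mem_nbhd.2 ⟨fun h => hW.1 hwW h h2, w, hwW, h2⟩, h1⟩
  have hDW : ∀ v ∈ D, v ∈ nbhd G W := fun v hv =>
    mem_nbhd.2 ⟨fun h => hW.1 hxW h (hD v hv).2.1, x, hxW, (hD v hv).2.1⟩
  have hDcard : D.card ≤ 1 := by
    have h1 : (D ∪ E.image m).card ≤ (W \ Y).card := by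
      have hsub : ∀ v ∈ D ∪ E.image m, v ∈ nbhd G W := fun v hv =>
        (Finset.mem_union.1 hv).elim (hDW v) (fun h => (hEimg v h).1)
      refine Finset.card_le_card_of_injOn k (fun v hv => ?_) (hk.1.mono fun v hv => hsub v hv)
      obtain ⟨h1, h2⟩ := hk.2 v (hsub v hv)
      refine Finset.mem_sdiff.2 ⟨h1, fun h3 => ?_⟩
      rcases Finset.mem_union.1 hv with hv | hv
      · exact (hD v hv).2.2 _ h3 h2.symm
      · exact hY.1 (hEimg v hv).2 h3 h2
    rw [Finset.card_union_of_disjoint, Finset.card_image_of_injOn] at h1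
    · have h2 := Finset.card_erase_add_one (Finset.mem_sdiff.2 ⟨hxW, hxY⟩)
      change E.card + 1 = _ at h2
      omega
    · exact hm.1.mono fun v hv => (hE v hv).2
    · rw [Finset.disjoint_left]
      exact fun v hv hv' => (hD v hv).1 (hEimg v hv').2
  let m' : V → V := fun v => if v ∈ nbhd G Y then m v else x
  have hpos : ∀ v ∈ nbhd G Y, m' v = m v := fun v hv => if_pos hv
  have hneg : ∀ v ∉ nbhd G Y, m' v = x := fun v hv => if_neg hv
  refine isLocalMaxStable_of_matchesInto (m := m') hstable ⟨?_, fun v hv => ?_⟩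
  · intro v hv w hw hvw
    by_cases h1 : v ∈ nbhd G Y <;> by_cases h2 : w ∈ nbhd G Y
    · rw [hpos v h1, hpos w h2] at hvw
      exact hm.1 h1 h2 hvw
    · rw [hpos v h1, hneg w h2] at hvw
      exact absurd (hvw ▸ (hm.2 v h1).1) hxY
    · rw [hneg v h1, hpos w h2] at hvw
      exact absurd (hvw ▸ (hm.2 w h2).1) hxY
    · exact Finset.card_le_one.1 hDcard v (Finset.mem_sdiff.2 ⟨hv, h1⟩) w
        (Finset.mem_sdiff.2 ⟨hw, h2⟩)
  · by_cases h1 : v ∈ nbhd G Y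
    · rw [hpos v h1]
      exact ⟨Finset.mem_insert_of_mem (hm.2 v h1).1, (hm.2 v h1).2⟩
    · rw [hneg v h1]
      exact ⟨Finset.mem_insert_self x Y, (hD v (Finset.mem_sdiff.2 ⟨hv, h1⟩)).2.1.symm⟩

/-- For a bipartite graph `G`, `Ψ(G)` is a greedoid on `V(G)` iff
all maximum matchings of `G` are uniquely restricted. -/
theorem bipartite_psi_greedoid_iff_all_max_matchings_ur (G : SimpleGraph V)
    (hb : ∃ A : Set V, ∀ x y : V, G.Adj x y → (x ∈ A ↔ y ∉ A)) :
    IsGreedoidFam (Psi G) ↔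
      ∀ M : Finset (Sym2 V), IsMaximumGMatching G M → UniquelyRestricted G M := by
  exact ⟨fun h M hM => uniquelyRestricted_of_accessible hb h.2.1 hM, fun h =>
    have hacc := accessible_of_uniquelyRestricted hb h
    ⟨⟨∅, empty_mem_Psi G⟩, hacc, exchange_of_accessible hb hacc⟩⟩
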